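/- arXiv:hep-th/0103164 — 3 statements merged into one kernel-verified Lean document; each statement's English description precedes it below -/
import Mathlib

section
/- Assume the coproduct Δ of H is cocommutative, i.e. τ ∘ Δ = Δ. Then the twisted data satisfies the quasi-Hopf hexagon relations in H ⊗ H ⊗ H: (Δ_F ⊗ id)(R̃) = φ̃₃₁₂ · R̃₁₃ · φ̃⁻¹₁₃₂ · R̃₂₃ · φ̃₁₂₃ and (id ⊗ Δ_F)(R̃) = φ̃⁻¹₂₃₁ · R̃₁₃ · φ̃₂₁₃ · R̃₁₂ · φ̃⁻¹₁₂₃. Here for X ∈ H ⊗ H one sets X₁₂ := X ⊗ 1, X₂₃ := 1 ⊗ X, X₁₃ := (id ⊗ τ)(X ⊗ 1), and for Y ∈ H ⊗ H ⊗ H the subscript Y_{i j k} denotes the element obtained by placing the first, second, third tensor factor of Y into positions i, j, k respectively. -/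
open scoped TensorProduct

noncomputable section

namespace QFTFuzzySphere

variable {k : Type*} [Field k]
variable {H : Type*} [Ring H] [Bialgebra k H]

/-- `(ε ⊗ id) : H ⊗ H → H`. -/
def epsId : H ⊗[k] H →ₗ[k] H :=
  (TensorProduct.lid k H).toLinearMap.comp
    (TensorProduct.map (Coalgebra.counit (R := k)) LinearMap.id)

/-- `(id ⊗ ε) : H ⊗ H → H`. -/
def idEps : H ⊗[k] H →ₗ[k] H :=
  (TensorProduct.rid k H).toLinearMap.comp
    (TensorProduct.map LinearMap.id (Coalgebra.counit (R := k)))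

/-- `X ⊗ 1 ∈ H ⊗ (H ⊗ H)` (legs 1 and 2). -/
def leg12 (X : H ⊗[k] H) : H ⊗[k] (H ⊗[k] H) :=
  (TensorProduct.assoc k H H H) (X ⊗ₜ[k] (1 : H))

/-- `1 ⊗ X ∈ H ⊗ (H ⊗ H)` (legs 2 and 3). -/
def leg23 (X : H ⊗[k] H) : H ⊗[k] (H ⊗[k] H) := (1 : H) ⊗ₜ[k] X

/-- The permutation of `H ⊗ (H ⊗ H)` exchanging tensor legs 2 and 3. -/
def perm132 : H ⊗[k] (H ⊗[k] H) ≃ₗ[k] H ⊗[k] (H ⊗[k] H) :=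
  TensorProduct.congr (LinearEquiv.refl k H) (TensorProduct.comm k H H)

/-- The permutation of `H ⊗ (H ⊗ H)` exchanging tensor legs 1 and 2. -/
def perm213 : H ⊗[k] (H ⊗[k] H) ≃ₗ[k] H ⊗[k] (H ⊗[k] H) :=
  (TensorProduct.assoc k H H H).symm ≪≫ₗ
    TensorProduct.congr (TensorProduct.comm k H H) (LinearEquiv.refl k H) ≪≫ₗ
      TensorProduct.assoc k H H H

/-- The cyclic permutation `x ⊗ y ⊗ z ↦ y ⊗ z ⊗ x`, i.e. `Y ↦ Y₃₁₂`. -/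
def sigma312 : H ⊗[k] (H ⊗[k] H) ≃ₗ[k] H ⊗[k] (H ⊗[k] H) :=
  perm213 ≪≫ₗ perm132

/-- The cyclic permutation `x ⊗ y ⊗ z ↦ z ⊗ x ⊗ y`, i.e. `Y ↦ Y₂₃₁`. -/
def sigma231 : H ⊗[k] (H ⊗[k] H) ≃ₗ[k] H ⊗[k] (H ⊗[k] H) :=
  perm132 ≪≫ₗ perm213

/-- `X₁₃ = (id ⊗ τ)(X ⊗ 1) ∈ H ⊗ (H ⊗ H)` (legs 1 and 3). -/
def leg13 (X : H ⊗[k] H) : H ⊗[k] (H ⊗[k] H) :=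
  perm132 (leg12 X)

/-- `(id ⊗ Δ) : H ⊗ H → H ⊗ (H ⊗ H)`. -/
def idDelta : H ⊗[k] H →ₗ[k] H ⊗[k] (H ⊗[k] H) :=
  TensorProduct.map LinearMap.id (Coalgebra.comul (R := k))

/-- `(Δ ⊗ id) : H ⊗ H → H ⊗ (H ⊗ H)` (composed with the associator). -/
def deltaId : H ⊗[k] H →ₗ[k] H ⊗[k] (H ⊗[k] H) :=
  (TensorProduct.assoc k H H H).toLinearMap.comp
    (TensorProduct.map (Coalgebra.comul (R := k)) LinearMap.id)

/-- The coassociator `φ̃ = (1 ⊗ F)·((id ⊗ Δ)F)·((Δ ⊗ id)F⁻¹)·(F⁻¹ ⊗ 1)`. -/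
def phiTilde (F Finv : H ⊗[k] H) : H ⊗[k] (H ⊗[k] H) :=
  leg23 F * idDelta F * deltaId Finv * leg12 Finv

/-- The twisted coproduct `Δ_F(u) = F·Δ(u)·F⁻¹`. -/
def DeltaF (F Finv : H ⊗[k] H) : H →ₗ[k] H ⊗[k] H :=
  (LinearMap.mulLeft k F).comp
    ((LinearMap.mulRight k Finv).comp (Coalgebra.comul (R := k)))

/-- The braiding element `R̃ = τ(F)·F⁻¹`. -/
def Rtilde (F Finv : H ⊗[k] H) : H ⊗[k] H :=
  (TensorProduct.comm k H H) F * Finv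

theorem mul_cancel_left {M : Type*} [Monoid M] {a b : M} (h : a * b = 1) (c : M) :
    a * (b * c) = c := by
  rw [← mul_assoc, h, one_mul]

/-! ### Multiplicativity of the structure maps -/

theorem comm_mul (X Y : H ⊗[k] H) :
    TensorProduct.comm k H H (X * Y) = TensorProduct.comm k H H X * TensorProduct.comm k H H Y :=
  map_mul (Algebra.TensorProduct.comm k H H) X Y

theorem leg12_mul (X Y : H ⊗[k] H) : leg12 (X * Y) = leg12 X * leg12 Y :=
  map_mul ((Algebra.TensorProduct.assoc k k k H H H).toAlgHom.comp
    (Algebra.TensorProduct.includeLeft (R := k) (S := k) (A := H ⊗[k] H) (B := H))) X Y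

theorem leg23_mul (X Y : H ⊗[k] H) : leg23 (X * Y) = leg23 X * leg23 Y :=
  map_mul (Algebra.TensorProduct.includeRight (R := k) (A := H) (B := H ⊗[k] H)) X Y

theorem perm132_mul (X Y : H ⊗[k] (H ⊗[k] H)) :
    perm132 (X * Y) = perm132 X * perm132 Y :=
  map_mul (Algebra.TensorProduct.congr (AlgEquiv.refl (R := k) (A₁ := H))
    (Algebra.TensorProduct.comm k H H)) X Y

theorem perm213_mul (X Y : H ⊗[k] (H ⊗[k] H)) :
    perm213 (X * Y) = perm213 X * perm213 Y :=
  map_mul ((Algebra.TensorProduct.assoc k k k H H H).symm.trans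
    ((Algebra.TensorProduct.congr (Algebra.TensorProduct.comm k H H)
      (AlgEquiv.refl (R := k) (A₁ := H))).trans
      (Algebra.TensorProduct.assoc k k k H H H))) X Y

theorem leg13_mul (X Y : H ⊗[k] H) : leg13 (X * Y) = leg13 X * leg13 Y := by
  simp only [leg13, leg12_mul, perm132_mul]

theorem idDelta_mul (X Y : H ⊗[k] H) : idDelta (X * Y) = idDelta X * idDelta Y :=
  map_mul (Algebra.TensorProduct.map (AlgHom.id k H) (Bialgebra.comulAlgHom k H)) X Y

theorem deltaId_mul (X Y : H ⊗[k] H) : deltaId (X * Y) = deltaId X * deltaId Y :=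
  map_mul ((Algebra.TensorProduct.assoc k k k H H H).toAlgHom.comp
    (Algebra.TensorProduct.map (Bialgebra.comulAlgHom k H) (AlgHom.id k H))) X Y

theorem perm132_one : perm132 (1 : H ⊗[k] (H ⊗[k] H)) = 1 := rfl

theorem perm213_one : perm213 (1 : H ⊗[k] (H ⊗[k] H)) = 1 := rfl

theorem idDelta_one : idDelta (1 : H ⊗[k] H) = 1 :=
  map_one (Algebra.TensorProduct.map (AlgHom.id k H) (Bialgebra.comulAlgHom k H))

theorem deltaId_one : deltaId (1 : H ⊗[k] H) = 1 :=
  map_one ((Algebra.TensorProduct.assoc k k k H H H).toAlgHom.comp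
    (Algebra.TensorProduct.map (Bialgebra.comulAlgHom k H) (AlgHom.id k H)))

/-! ### Preservation of inverses -/

section Inverses

variable {X Y : H ⊗[k] H}

theorem comm_mul_eq_one (h : X * Y = 1) :
    TensorProduct.comm k H H X * TensorProduct.comm k H H Y = 1 := by
  rw [← comm_mul, h]; rfl

theorem leg12_mul_eq_one (h : X * Y = 1) : leg12 X * leg12 Y = 1 := by
  rw [← leg12_mul, h]; rfl

theorem leg23_mul_eq_one (h : X * Y = 1) : leg23 X * leg23 Y = 1 := by
  rw [← leg23_mul, h]; rfl

theorem leg13_mul_eq_one (h : X * Y = 1) : leg13 X * leg13 Y = 1 := by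
  rw [← leg13_mul, h]; rfl

theorem idDelta_mul_eq_one (h : X * Y = 1) : idDelta X * idDelta Y = 1 := by
  rw [← idDelta_mul, h, idDelta_one]

theorem deltaId_mul_eq_one (h : X * Y = 1) : deltaId X * deltaId Y = 1 := by
  rw [← deltaId_mul, h, deltaId_one]

end Inverses

theorem perm132_mul_eq_one {X Y : H ⊗[k] (H ⊗[k] H)} (h : X * Y = 1) :
    perm132 X * perm132 Y = 1 := by
  rw [← perm132_mul, h, perm132_one]

theorem perm213_mul_eq_one {X Y : H ⊗[k] (H ⊗[k] H)} (h : X * Y = 1) :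
    perm213 X * perm213 Y = 1 := by
  rw [← perm213_mul, h, perm213_one]

/-- The inverse of `φ̃` is `(F ⊗ 1)·((Δ ⊗ id)F)·((id ⊗ Δ)F⁻¹)·(1 ⊗ F⁻¹)`. -/
theorem phiTilde_mul_inverse {F Finv : H ⊗[k] H} (hF : F * Finv = 1) (hF' : Finv * F = 1) :
    phiTilde F Finv * (leg12 F * deltaId F * idDelta Finv * leg23 Finv) = 1 := by
  simp only [phiTilde, mul_assoc]
  rw [mul_cancel_left (leg12_mul_eq_one hF'), mul_cancel_left (deltaId_mul_eq_one hF'),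
    mul_cancel_left (idDelta_mul_eq_one hF), leg23_mul_eq_one hF]

/-! ### Action of the permutations on the legs -/

theorem sigma312_apply (Y : H ⊗[k] (H ⊗[k] H)) : sigma312 Y = perm132 (perm213 Y) := rfl

theorem sigma231_apply (Y : H ⊗[k] (H ⊗[k] H)) : sigma231 Y = perm213 (perm132 Y) := rfl

theorem perm132_leg12 (X : H ⊗[k] H) : perm132 (leg12 X) = leg13 X := rfl

theorem perm132_leg23 (X : H ⊗[k] H) :
    perm132 (leg23 X) = leg23 (TensorProduct.comm k H H X) := rfl

theorem perm132_perm132 (Y : H ⊗[k] (H ⊗[k] H)) : perm132 (perm132 Y) = Y := by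
  induction Y using TensorProduct.induction_on with
  | zero => simp only [map_zero]
  | add A B hA hB => simp only [map_add, hA, hB]
  | tmul x Z => simp [perm132]

theorem perm132_leg13 (X : H ⊗[k] H) : perm132 (leg13 X) = leg12 X :=
  perm132_perm132 _

theorem perm213_leg12 (X : H ⊗[k] H) :
    perm213 (leg12 X) = leg12 (TensorProduct.comm k H H X) := by
  simp [perm213, leg12]

theorem leg23_zero : leg23 (0 : H ⊗[k] H) = 0 := TensorProduct.tmul_zero _ _

theorem leg23_add (X Y : H ⊗[k] H) : leg23 (X + Y) = leg23 X + leg23 Y :=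
  TensorProduct.tmul_add _ _ _

theorem leg13_zero : leg13 (0 : H ⊗[k] H) = 0 := by simp [leg13, leg12]

theorem leg13_add (X Y : H ⊗[k] H) : leg13 (X + Y) = leg13 X + leg13 Y := by
  simp [leg13, leg12, TensorProduct.add_tmul]

theorem perm213_leg23 (X : H ⊗[k] H) : perm213 (leg23 X) = leg13 X := by
  induction X using TensorProduct.induction_on with
  | zero => simp only [leg23_zero, leg13_zero, map_zero]
  | add A B hA hB => simp only [leg23_add, leg13_add, map_add, hA, hB]
  | tmul x y => rfl

theorem perm213_leg13 (X : H ⊗[k] H) : perm213 (leg13 X) = leg23 X := by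
  induction X using TensorProduct.induction_on with
  | zero => simp only [leg23_zero, leg13_zero, map_zero]
  | add A B hA hB => simp only [leg23_add, leg13_add, map_add, hA, hB]
  | tmul x y => rfl

theorem perm132_idDelta
    (hcc : ∀ u : H, (TensorProduct.comm k H H) (Coalgebra.comul u) = Coalgebra.comul u)
    (X : H ⊗[k] H) : perm132 (idDelta X) = idDelta X := by
  induction X using TensorProduct.induction_on with
  | zero => simp only [map_zero]
  | add A B hA hB => simp only [map_add, hA, hB]
  | tmul x y => simp [perm132, idDelta, hcc]

theorem perm213_deltaId
    (hcc : ∀ u : H, (TensorProduct.comm k H H) (Coalgebra.comul u) = Coalgebra.comul u)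
    (X : H ⊗[k] H) : perm213 (deltaId X) = deltaId X := by
  induction X using TensorProduct.induction_on with
  | zero => simp only [map_zero]
  | add A B hA hB => simp only [map_add, hA, hB]
  | tmul x y => simp [perm213, deltaId, hcc]

theorem perm132_perm213_tmul (x : H) (Z : H ⊗[k] H) :
    perm132 (perm213 (x ⊗ₜ[k] Z)) = TensorProduct.assoc k H H H (Z ⊗ₜ[k] x) := by
  induction Z using TensorProduct.induction_on with
  | zero => simp only [TensorProduct.tmul_zero, TensorProduct.zero_tmul, map_zero]
  | add A B hA hB => simp only [TensorProduct.tmul_add, TensorProduct.add_tmul, map_add, hA, hB]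
  | tmul y z => rfl

theorem perm213_perm132_assoc_tmul (Z : H ⊗[k] H) (z : H) :
    perm213 (perm132 (TensorProduct.assoc k H H H (Z ⊗ₜ[k] z))) = z ⊗ₜ[k] Z := by
  induction Z using TensorProduct.induction_on with
  | zero => simp only [TensorProduct.tmul_zero, TensorProduct.zero_tmul, map_zero]
  | add A B hA hB => simp only [TensorProduct.tmul_add, TensorProduct.add_tmul, map_add, hA, hB]
  | tmul x y => rfl

theorem perm132_perm213_idDelta (X : H ⊗[k] H) :
    perm132 (perm213 (idDelta X)) = deltaId (TensorProduct.comm k H H X) := by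
  induction X using TensorProduct.induction_on with
  | zero => simp only [map_zero]
  | add A B hA hB => simp only [map_add, hA, hB]
  | tmul x y => exact perm132_perm213_tmul x (Coalgebra.comul y)

theorem perm213_perm132_deltaId (X : H ⊗[k] H) :
    perm213 (perm132 (deltaId X)) = idDelta (TensorProduct.comm k H H X) := by
  induction X using TensorProduct.induction_on with
  | zero => simp only [map_zero]
  | add A B hA hB => simp only [map_add, hA, hB]
  | tmul x y => exact perm213_perm132_assoc_tmul (Coalgebra.comul x) y

/-! ### The twisted coproduct on a tensor leg -/

theorem assoc_map_DeltaF (F Finv X : H ⊗[k] H) :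
    TensorProduct.assoc k H H H (TensorProduct.map (DeltaF F Finv) LinearMap.id X) =
      leg12 F * (deltaId X * leg12 Finv) := by
  induction X using TensorProduct.induction_on with
  | zero => simp only [map_zero, zero_mul, mul_zero]
  | add A B hA hB => simp only [map_add, hA, hB, add_mul, mul_add]
  | tmul x y =>
    have h := map_mul (Algebra.TensorProduct.assoc k k k H H H)
    change _ = Algebra.TensorProduct.assoc k k k H H H (F ⊗ₜ[k] 1) *
      (Algebra.TensorProduct.assoc k k k H H H (Coalgebra.comul x ⊗ₜ[k] y) *
        Algebra.TensorProduct.assoc k k k H H H (Finv ⊗ₜ[k] 1))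
    rw [← h, ← h, Algebra.TensorProduct.tmul_mul_tmul, Algebra.TensorProduct.tmul_mul_tmul,
      mul_one, one_mul]
    rfl

theorem map_id_DeltaF (F Finv X : H ⊗[k] H) :
    TensorProduct.map LinearMap.id (DeltaF F Finv) X =
      leg23 F * (idDelta X * leg23 Finv) := by
  induction X using TensorProduct.induction_on with
  | zero => simp only [map_zero, zero_mul, mul_zero]
  | add A B hA hB => simp only [map_add, hA, hB, add_mul, mul_add]
  | tmul x y => simp [leg23, idDelta, DeltaF]

/-- if `Δ` is cocommutative, the twisted data satisfies the quasi-Hopf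
hexagon relations
`(Δ_F ⊗ id)(R̃) = φ̃₃₁₂·R̃₁₃·φ̃⁻¹₁₃₂·R̃₂₃·φ̃₁₂₃` and
`(id ⊗ Δ_F)(R̃) = φ̃⁻¹₂₃₁·R̃₁₃·φ̃₂₁₃·R̃₁₂·φ̃⁻¹₁₂₃`. -/
theorem twisted_hexagon_relations
    (hcc : ∀ u : H, (TensorProduct.comm k H H) (Coalgebra.comul u) = Coalgebra.comul u)
    (F Finv : H ⊗[k] H) (hF : F * Finv = 1) (hF' : Finv * F = 1)
    (hcounitl : epsId (k := k) (H := H) F = 1) (hcounitr : idEps (k := k) (H := H) F = 1)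
    (phiInv : H ⊗[k] (H ⊗[k] H))
    (hphi : phiTilde F Finv * phiInv = 1) (hphi' : phiInv * phiTilde F Finv = 1) :
    (TensorProduct.assoc k H H H)
        ((TensorProduct.map (DeltaF F Finv) LinearMap.id) (Rtilde F Finv)) =
      sigma312 (phiTilde F Finv) * leg13 (Rtilde F Finv) * perm132 phiInv *
        leg23 (Rtilde F Finv) * phiTilde F Finv ∧
    (TensorProduct.map LinearMap.id (DeltaF F Finv)) (Rtilde F Finv) =
      sigma231 phiInv * leg13 (Rtilde F Finv) * perm213 (phiTilde F Finv) *
        leg12 (Rtilde F Finv) * phiInv := by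
  have hphiInv : phiInv = leg12 F * deltaId F * idDelta Finv * leg23 Finv :=
    left_inv_eq_right_inv hphi' (phiTilde_mul_inverse hF hF')
  have hC := comm_mul_eq_one hF'
  have p132 := perm132_idDelta hcc
  have p213 := perm213_deltaId hcc
  constructor
  · rw [assoc_map_DeltaF, hphiInv]
    simp only [phiTilde, Rtilde, sigma312_apply, perm132_mul, perm213_mul, leg13_mul,
      leg23_mul, deltaId_mul, perm132_leg12, perm132_leg13, perm132_leg23, perm213_leg12,
      perm213_leg23, p132, p213, perm132_perm213_idDelta, mul_assoc]
    rw [mul_cancel_left (leg13_mul_eq_one hC), mul_cancel_left (leg13_mul_eq_one hF'),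
      mul_cancel_left (perm132_mul_eq_one (deltaId_mul_eq_one hF')),
      mul_cancel_left (leg23_mul_eq_one hC), mul_cancel_left (leg23_mul_eq_one hF'),
      mul_cancel_left (idDelta_mul_eq_one hF')]
  · rw [map_id_DeltaF, hphiInv]
    simp only [phiTilde, Rtilde, sigma231_apply, perm132_mul, perm213_mul, leg12_mul, leg13_mul,
      idDelta_mul, perm132_leg12, perm132_leg23, perm213_leg12, perm213_leg13,
      perm213_leg23, p132, p213, perm213_perm132_deltaId, mul_assoc]
    rw [mul_cancel_left (leg13_mul_eq_one hC), mul_cancel_left (leg13_mul_eq_one hF'),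
      mul_cancel_left (perm213_mul_eq_one (idDelta_mul_eq_one hF')),
      mul_cancel_left (leg12_mul_eq_one hC), mul_cancel_left (leg12_mul_eq_one hF'),
      mul_cancel_left (deltaId_mul_eq_one hF')]

end QFTFuzzySphere
end
end

section
/- Fix a real number q > 1 and a real number c > 0. Then (1/N)·∑_{L=0}^{N} [2L+1]_q / ([L]_q·[L+1]_q + c) tends to q − q⁻¹ as N → ∞. In particular, the planar tadpole contribution diverges linearly in the cutoff N whenever q ≠ 1. -/
/-- The symmetric `q`-integer `[n]_q = (qⁿ − q⁻ⁿ)/(q − q⁻¹)`. -/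
noncomputable def qInt (q : ℝ) (n : ℕ) : ℝ :=
  (q ^ (n : ℤ) - q ^ (-(n : ℤ))) / (q - q⁻¹)

/-- The summand as a rational function of `x = q⁻ᴸ`, regular at `x = 0`. -/
lemma qInt_summand_eq (q : ℝ) (hq : 1 < q) (c : ℝ) (L : ℕ) :
    qInt q (2 * L + 1) / (qInt q L * qInt q (L + 1) + c) =
      (q - q⁻¹) * (1 - (q⁻¹ ^ L) ^ 4 * q⁻¹ ^ 2) /
        ((1 - (q⁻¹ ^ L) ^ 2) * (1 - (q⁻¹ ^ L) ^ 2 * q⁻¹ ^ 2) +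
          c * (q - q⁻¹) ^ 2 * (q⁻¹ ^ L) ^ 2 * q⁻¹) := by
  have hq0 : q ≠ 0 := by positivity
  have hd : q - q⁻¹ ≠ 0 := (sub_pos.2 ((inv_lt_one_of_one_lt₀ hq).trans hq)).ne'
  have hy : q ^ L ≠ 0 := pow_ne_zero _ hq0
  simp only [qInt, zpow_neg, zpow_natCast, pow_succ q, pow_mul', inv_pow]
  generalize q ^ L = y at hy ⊢
  generalize hdd : q - q⁻¹ = d at hd ⊢
  rw [← mul_div_mul_left _ _ (show d ^ 2 * (y⁻¹ ^ 2 * q⁻¹) ≠ 0 by positivity)]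
  congr 1 <;> field_simp

lemma tendsto_qInt_summand (q : ℝ) (hq : 1 < q) (c : ℝ) :
    Filter.Tendsto
      (fun L : ℕ => qInt q (2 * L + 1) / (qInt q L * qInt q (L + 1) + c))
      Filter.atTop (nhds (q - q⁻¹)) := by
  simp only [qInt_summand_eq q hq c]
  have hx : Filter.Tendsto (fun L : ℕ => q⁻¹ ^ L) Filter.atTop (nhds 0) :=
    tendsto_pow_atTop_nhds_zero_of_lt_one (by positivity) (inv_lt_one_of_one_lt₀ hq)
  have hf : ContinuousAt (fun x : ℝ => (q - q⁻¹) * (1 - x ^ 4 * q⁻¹ ^ 2) /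
      ((1 - x ^ 2) * (1 - x ^ 2 * q⁻¹ ^ 2) + c * (q - q⁻¹) ^ 2 * x ^ 2 * q⁻¹)) 0 :=
    ContinuousAt.div (by fun_prop) (by fun_prop) (by simp)
  simpa [Function.comp_def] using hf.tendsto.comp hx

/-- Cesàro averages with one extra summand. -/
lemma tendsto_one_div_mul_sum_range_succ {u : ℕ → ℝ} {l : ℝ}
    (h : Filter.Tendsto u Filter.atTop (nhds l)) :
    Filter.Tendsto (fun N : ℕ => (1 / (N : ℝ)) * ∑ L ∈ Finset.range (N + 1), u L)
      Filter.atTop (nhds l) := by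
  have hlast := (tendsto_inv_atTop_nhds_zero_nat (𝕜 := ℝ)).mul h
  simpa [Finset.sum_range_succ, mul_add] using h.cesaro.add hlast

/-- for `q > 1` and `c > 0`, the Cesàro average
`(1/N)·∑_{L=0}^{N} [2L+1]_q / ([L]_q·[L+1]_q + c)` tends to `q − q⁻¹` as `N → ∞`;
hence the planar tadpole contribution diverges linearly in the cutoff `N`. -/
theorem tadpole_diverges_linearly (q : ℝ) (hq : 1 < q) (c : ℝ) (hc : 0 < c) :
    Filter.Tendsto
      (fun N : ℕ =>
        (1 / (N : ℝ)) *
          ∑ L ∈ Finset.range (N + 1),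
            qInt q (2 * L + 1) / (qInt q L * qInt q (L + 1) + c))
      Filter.atTop (nhds (q - q⁻¹)) := by
  exact tendsto_one_div_mul_sum_range_succ (tendsto_qInt_summand q hq c)
end

section
/- Fix a real number q > 1. Then the series ∑_{L=1}^{∞} [2L+1]_q / [2L(L+1)]_q is summable. (Hence with the alternative Laplacian whose eigenvalues are [2L(L+1)]_q, the tadpole diagram converges as the cutoff N → ∞.) -/
theorem qInt_nonneg {q : ℝ} (hq : 1 < q) (n : ℕ) : 0 ≤ qInt q n := by
  have hinv : q⁻¹ < 1 := inv_lt_one_of_one_lt₀ hq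
  refine div_nonneg (sub_nonneg.2 (zpow_le_zpow_right₀ hq.le ?_)) (by linarith)
  omega

theorem qInt_div_qInt_le {q : ℝ} (hq : 1 < q) {a b k : ℕ} (hb : 1 ≤ b) (h : a + k ≤ b) :
    qInt q a / qInt q b ≤ (1 - q⁻¹)⁻¹ * q⁻¹ ^ k := by
  have hq0 : 0 < q := by linarith
  have hinv : q⁻¹ < 1 := inv_lt_one_of_one_lt₀ hq
  have hd : q - q⁻¹ ≠ 0 := by linarith
  have hr : 0 < 1 - q⁻¹ := by linarith
  unfold qInt
  rw [div_div_div_cancel_right₀ hd]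
  simp only [zpow_neg, zpow_natCast]
  have hlow : q ^ b * (1 - q⁻¹) ≤ q ^ b - (q ^ b)⁻¹ := by
    obtain ⟨c, rfl⟩ := Nat.exists_eq_add_of_le' hb
    have h1 : q ^ (c + 1) * q⁻¹ = q ^ c := by
      rw [pow_succ, mul_inv_cancel_right₀ hq0.ne']
    have h2 : (q ^ (c + 1))⁻¹ ≤ 1 := inv_le_one_of_one_le₀ (one_le_pow₀ hq.le)
    have h3 : 1 ≤ q ^ c := one_le_pow₀ hq.le
    linarith [mul_sub (q ^ (c + 1)) 1 q⁻¹]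
  have hpos : 0 < q ^ b * (1 - q⁻¹) := by positivity
  have hnum : q ^ a ≤ q⁻¹ ^ k * q ^ b := by
    rw [inv_pow, ← div_eq_inv_mul, le_div_iff₀ (by positivity), ← pow_add]
    exact pow_le_pow_right₀ hq.le h
  have hinva : 0 < (q ^ a)⁻¹ := by positivity
  rw [div_le_iff₀ (hpos.trans_le hlow)]
  calc q ^ a - (q ^ a)⁻¹ ≤ q⁻¹ ^ k * q ^ b := by linarith
    _ = (1 - q⁻¹)⁻¹ * q⁻¹ ^ k * (q ^ b * (1 - q⁻¹)) := by
      rw [mul_comm (q ^ b), ← mul_assoc, mul_right_comm _ _ (1 - q⁻¹),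
        inv_mul_cancel₀ hr.ne', one_mul]
    _ ≤ _ := by gcongr

/-- for `q > 1`, the series `∑_{L=1}^{∞} [2L+1]_q / [2L(L+1)]_q` is
summable; hence with the Laplacian with eigenvalues `[2L(L+1)]_q` the tadpole diagram
converges as the cutoff `N → ∞`. -/
theorem tadpole_summable_alternative_laplacian (q : ℝ) (hq : 1 < q) :
    Summable (fun L : ℕ => qInt q (2 * (L + 1) + 1) / qInt q (2 * (L + 1) * (L + 2))) := by
  have hinv : q⁻¹ < 1 := inv_lt_one_of_one_lt₀ hq
  refine Summable.of_nonneg_of_le (fun L => div_nonneg (qInt_nonneg hq _) (qInt_nonneg hq _))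
    (fun L => qInt_div_qInt_le (k := L) hq ?_ ?_)
    ((summable_geometric_of_lt_one (by positivity) hinv).mul_left _)
  · nlinarith
  · nlinarith
end
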